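/- The element C⁽²⁾ = −p⁻¹⁰L₁⁻²L₂⁻⁴ − p⁻⁴L₁⁻²L₂² − p²L₁⁴L₂² − p⁻¹κ²F₁E₁L₁L₂² − p⁻⁷κ²F₂E₂L₁⁻²L₂⁻¹ − p⁻¹κ²F₃E₃L₁L₂⁻¹ − p⁻¹κ³F₁F₂E₃L₁L₂⁻¹ is central in U_q(sl₃); that is, C⁽²⁾ commutes with each of the generators E₁, E₂, F₁, F₂, L₁, L₂ of A. (Written with q = p³ and L_i = q^{H_i/3}, this is the quantum Casimir element C⁽²⁾ = −q^{−(2H₁+4H₂+10)/3} − q^{−(2H₁−2H₂+4)/3} − q^{(4H₁+2H₂+2)/3} − κ_q²F₁E₁q^{(H₁+2H₂−1)/3} − κ_q²F₂E₂q^{−(2H₁+H₂+7)/3} − κ_q²F₃E₃q^{(H₁−H₂−1)/3} − κ_q³F₁F₂E₃q^{(H₁−H₂−1)/3} of U_q(sl₃).) -/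

import Mathlib

theorem c2aux_assoc {A : Type*} [Ring A] {a b c : A} (h : a * b = c) (x : A) :
    a * (b * x) = c * x := by rw [← mul_assoc, h]

theorem c2aux_inv {A : Type*} [Ring A] [Algebra ℂ A] {L L' X : A} {c d : ℂ}
    (h1 : L * L' = 1) (h2 : L' * L = 1) (hcd : d * c = 1) (h : L * X = c • (X * L)) :
    L' * X = d • (X * L') := by
  have e : L' * (L * X) * L' = c • (L' * X) := by
    rw [h, mul_smul_comm, smul_mul_assoc, mul_assoc, mul_assoc X, h1, mul_one]
  rw [← mul_assoc, h2, one_mul] at e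
  rw [e, smul_smul, hcd, one_smul]

theorem c2aux_inv1 {A : Type*} [Ring A] {L L' X : A}
    (h1 : L * L' = 1) (h2 : L' * L = 1) (h : L * X = X * L) :
    L' * X = X * L' := by
  have e : L' * (L * X) * L' = L' * X := by
    rw [h, mul_assoc, mul_assoc X, h1, mul_one]
  rw [← mul_assoc, h2, one_mul] at e
  exact e.symm

set_option linter.unusedSimpArgs false in
set_option maxHeartbeats 4000000 in
/-- The quantum Casimir element `C⁽²⁾` of `U_q(sl₃)` (written with `q = p³`,
`L_i = q^{H_i/3}`) is central. -/
theorem sl3_casimir_C2_central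
    {A : Type*} [Ring A] [Algebra ℂ A]
    (p : ℂ) (hp0 : p ≠ 0) (hp6 : p ^ 6 ≠ 1)
    (L1 L2 L1' L2' E1 E2 F1 F2 E3 F3 : A)
    (hL1 : L1 * L1' = 1) (hL1' : L1' * L1 = 1)
    (hL2 : L2 * L2' = 1) (hL2' : L2' * L2 = 1)
    (hL12 : L1 * L2 = L2 * L1)
    (hL1E1 : L1 * E1 = (p ^ 2) • (E1 * L1)) (hL1E2 : L1 * E2 = p⁻¹ • (E2 * L1))
    (hL2E1 : L2 * E1 = p⁻¹ • (E1 * L2)) (hL2E2 : L2 * E2 = (p ^ 2) • (E2 * L2))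
    (hL1F1 : L1 * F1 = (p⁻¹ ^ 2) • (F1 * L1)) (hL1F2 : L1 * F2 = p • (F2 * L1))
    (hL2F1 : L2 * F1 = p • (F1 * L2)) (hL2F2 : L2 * F2 = (p⁻¹ ^ 2) • (F2 * L2))
    (hEF1 : E1 * F1 - F1 * E1 = (p ^ 3 - p⁻¹ ^ 3)⁻¹ • (L1 ^ 3 - L1' ^ 3))
    (hEF2 : E2 * F2 - F2 * E2 = (p ^ 3 - p⁻¹ ^ 3)⁻¹ • (L2 ^ 3 - L2' ^ 3))
    (hEF12 : E1 * F2 = F2 * E1) (hEF21 : E2 * F1 = F1 * E2)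
    (hSE1 : E1 ^ 2 * E2 - (p ^ 3 + p⁻¹ ^ 3) • (E1 * E2 * E1) + E2 * E1 ^ 2 = 0)
    (hSE2 : E2 ^ 2 * E1 - (p ^ 3 + p⁻¹ ^ 3) • (E2 * E1 * E2) + E1 * E2 ^ 2 = 0)
    (hSF1 : F1 ^ 2 * F2 - (p ^ 3 + p⁻¹ ^ 3) • (F1 * F2 * F1) + F2 * F1 ^ 2 = 0)
    (hSF2 : F2 ^ 2 * F1 - (p ^ 3 + p⁻¹ ^ 3) • (F2 * F1 * F2) + F1 * F2 ^ 2 = 0)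
    (hE3 : E3 = E1 * E2 - (p⁻¹ ^ 3) • (E2 * E1))
    (hF3 : F3 = F2 * F1 - (p ^ 3) • (F1 * F2))
    (C2 : A)
    (hC2 : C2 = -((p⁻¹ ^ 10) • (L1' ^ 2 * L2' ^ 4)) - (p⁻¹ ^ 4) • (L1' ^ 2 * L2 ^ 2)
      - (p ^ 2) • (L1 ^ 4 * L2 ^ 2)
      - (p⁻¹ * (p ^ 3 - p⁻¹ ^ 3) ^ 2) • (F1 * E1 * (L1 * L2 ^ 2))
      - (p⁻¹ ^ 7 * (p ^ 3 - p⁻¹ ^ 3) ^ 2) • (F2 * E2 * (L1' ^ 2 * L2'))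
      - (p⁻¹ * (p ^ 3 - p⁻¹ ^ 3) ^ 2) • (F3 * E3 * (L1 * L2'))
      - (p⁻¹ * (p ^ 3 - p⁻¹ ^ 3) ^ 3) • (F1 * F2 * E3 * (L1 * L2'))) :
    C2 * E1 = E1 * C2 ∧ C2 * E2 = E2 * C2 ∧ C2 * F1 = F1 * C2 ∧ C2 * F2 = F2 * C2 ∧ C2 * L1 = L1 * C2 ∧ C2 * L2 = L2 * C2 := by
  have hp6' : p ^ 6 - 1 ≠ 0 := sub_ne_zero.mpr hp6
  have hk : (p ^ 3 - p⁻¹ ^ 3)⁻¹ = p ^ 3 / (p ^ 6 - 1) := by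
    have : p ^ 3 - p⁻¹ ^ 3 = (p ^ 6 - 1) / p ^ 3 := by field_simp
    rw [this, inv_div]
  rw [hk] at hEF1 hEF2
  have hL1E1' := c2aux_inv (d := p⁻¹ ^ 2) hL1 hL1' (by field_simp) hL1E1
  have hL1E2' := c2aux_inv (d := p) hL1 hL1' (by field_simp) hL1E2
  have hL2E1' := c2aux_inv (d := p) hL2 hL2' (by field_simp) hL2E1
  have hL2E2' := c2aux_inv (d := p⁻¹ ^ 2) hL2 hL2' (by field_simp) hL2E2
  have hL1F1' := c2aux_inv (d := p ^ 2) hL1 hL1' (by field_simp) hL1F1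
  have hL1F2' := c2aux_inv (d := p⁻¹) hL1 hL1' (by field_simp) hL1F2
  have hL2F1' := c2aux_inv (d := p⁻¹) hL2 hL2' (by field_simp) hL2F1
  have hL2F2' := c2aux_inv (d := p ^ 2) hL2 hL2' (by field_simp) hL2F2
  have hA := hL12.symm
  have hB := (c2aux_inv1 hL1 hL1' hL12).symm
  have hC := c2aux_inv1 hL2 hL2' hA
  have hD := c2aux_inv1 hL2 hL2' hB
  have hG1 : E1 * F1 = F1 * E1 + (p ^ 3 / (p ^ 6 - 1)) • (L1 ^ 3 - L1' ^ 3) := by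
    rw [← hEF1]; abel
  have hG2 : E2 * F2 = F2 * E2 + (p ^ 3 / (p ^ 6 - 1)) • (L2 ^ 3 - L2' ^ 3) := by
    rw [← hEF2]; abel
  have hSEa : E1 * (E1 * E2) = (p ^ 3 + p⁻¹ ^ 3) • (E1 * (E2 * E1)) - E2 * (E1 * E1) := by
    rw [← sub_eq_zero, ← hSE1]; simp only [pow_two, mul_assoc]; abel
  have hSEb : E1 * (E2 * E2) = (p ^ 3 + p⁻¹ ^ 3) • (E2 * (E1 * E2)) - E2 * (E2 * E1) := by
    rw [← sub_eq_zero, ← hSE2]; simp only [pow_two, mul_assoc]; abel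
  have hSEa' : ∀ x, E1 * (E1 * (E2 * x)) = (p ^ 3 + p⁻¹ ^ 3) • (E1 * (E2 * (E1 * x))) - E2 * (E1 * (E1 * x)) := by
    intro x
    have := congrArg (· * x) hSEa
    simpa only [sub_mul, smul_mul_assoc, mul_assoc] using this
  have hSEb' : ∀ x, E1 * (E2 * (E2 * x)) = (p ^ 3 + p⁻¹ ^ 3) • (E2 * (E1 * (E2 * x))) - E2 * (E2 * (E1 * x)) := by
    intro x
    have := congrArg (· * x) hSEb
    simpa only [sub_mul, smul_mul_assoc, mul_assoc] using this
  have hSFa : F1 * (F1 * F2) = (p ^ 3 + p⁻¹ ^ 3) • (F1 * (F2 * F1)) - F2 * (F1 * F1) := by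
    rw [← sub_eq_zero, ← hSF1]; simp only [pow_two, mul_assoc]; abel
  have hSFb : F1 * (F2 * F2) = (p ^ 3 + p⁻¹ ^ 3) • (F2 * (F1 * F2)) - F2 * (F2 * F1) := by
    rw [← sub_eq_zero, ← hSF2]; simp only [pow_two, mul_assoc]; abel
  have hSFa' : ∀ x, F1 * (F1 * (F2 * x)) = (p ^ 3 + p⁻¹ ^ 3) • (F1 * (F2 * (F1 * x))) - F2 * (F1 * (F1 * x)) := by
    intro x
    have := congrArg (· * x) hSFa
    simpa only [sub_mul, smul_mul_assoc, mul_assoc] using this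
  have hSFb' : ∀ x, F1 * (F2 * (F2 * x)) = (p ^ 3 + p⁻¹ ^ 3) • (F2 * (F1 * (F2 * x))) - F2 * (F2 * (F1 * x)) := by
    intro x
    have := congrArg (· * x) hSFb
    simpa only [sub_mul, smul_mul_assoc, mul_assoc] using this
  subst hE3 hF3 hC2
  refine ⟨?_, ?_, ?_, ?_, ?_, ?_⟩
  all_goals
    simp only [pow_succ, pow_zero, one_mul, mul_one, mul_sub, sub_mul, mul_add, add_mul, neg_mul, mul_neg,
      smul_mul_assoc, mul_smul_comm, smul_sub, smul_add, smul_neg, smul_smul, mul_assoc,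
      hL1, c2aux_assoc hL1, hL1', c2aux_assoc hL1', hL2, c2aux_assoc hL2, hL2', c2aux_assoc
      hL2', hL1E1, c2aux_assoc hL1E1, hL1E1', c2aux_assoc hL1E1', hL1E2, c2aux_assoc hL1E2,
      hL1E2', c2aux_assoc hL1E2', hL1F1, c2aux_assoc hL1F1, hL1F1', c2aux_assoc hL1F1', hL1F2,
      c2aux_assoc hL1F2, hL1F2', c2aux_assoc hL1F2', hL2E1, c2aux_assoc hL2E1, hL2E1',
      c2aux_assoc hL2E1', hL2E2, c2aux_assoc hL2E2, hL2E2', c2aux_assoc hL2E2', hL2F1,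
      c2aux_assoc hL2F1, hL2F1', c2aux_assoc hL2F1', hL2F2, c2aux_assoc hL2F2, hL2F2',
      c2aux_assoc hL2F2', hA, c2aux_assoc hA, hB, c2aux_assoc hB, hC, c2aux_assoc hC, hD,
      c2aux_assoc hD, hG1, c2aux_assoc hG1, hG2, c2aux_assoc hG2, hEF12, c2aux_assoc hEF12,
      hEF21, c2aux_assoc hEF21, hSEa, hSEa', hSEb, hSEb', hSFa, hSFa', hSFb, hSFb']
    match_scalars
  all_goals
    field_simp
    try ring
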